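/- Let 𝒞 be the bicyclic inverse semigroup. Then ℓ¹(𝒞) is module biflat as an ℓ¹(E_𝒞)-module (with trivial left action), but ℓ¹(𝒞) is not module biprojective as an ℓ¹(E_𝒞)-module. -/

import Mathlib

noncomputable section

open scoped Topology

universe u u₁ u₂ u₃ v w

/-- The smallest closed two-sided ideal (realized as a `ℂ`-submodule which is topologically
closed and stable under multiplication by arbitrary elements) containing a given set. -/
def closedIdealGen {R : Type u} [NonUnitalNormedRing R] [NormedSpace ℂ R] (s : Set R) :
    Submodule ℂ R :=
  sInf {p : Submodule ℂ R |
    s ⊆ (p : Set R) ∧ IsClosed (p : Set R) ∧ ∀ x ∈ p, ∀ y : R, x * y ∈ p ∧ y * x ∈ p}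

/-- Data exhibiting the Banach space `TB` as the projective tensor product `B ⊗̂ B` of a
Banach algebra `B` with itself. -/
structure TensorSquareSetting (B : Type u) (TB : Type v)
    [NonUnitalNormedRing B] [NormedSpace ℂ B] [CompleteSpace B]
    [NonUnitalNormedRing TB] [NormedSpace ℂ TB] [CompleteSpace TB] where
  tp : B → B → TB
  tp_add_left : ∀ a b c, tp (a + b) c = tp a c + tp b c
  tp_add_right : ∀ a b c, tp a (b + c) = tp a b + tp a c
  tp_smul_left : ∀ (z : ℂ) a b, tp (z • a) b = z • tp a b
  tp_smul_right : ∀ (z : ℂ) a b, tp a (z • b) = z • tp a b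
  tp_norm : ∀ a b, ‖tp a b‖ ≤ ‖a‖ * ‖b‖
  tp_mul : ∀ a b c d, tp a b * tp c d = tp (a * c) (b * d)
  tp_dense :
    Dense ((Submodule.span ℂ (Set.range fun p : B × B => tp p.1 p.2) : Submodule ℂ TB) : Set TB)
  tp_universal : ∀ {X : Type w} [NormedAddCommGroup X] [NormedSpace ℂ X] [CompleteSpace X]
      (φ : B →L[ℂ] B →L[ℂ] X),
      ∃ ψ : TB →L[ℂ] X, ‖ψ‖ ≤ ‖φ‖ ∧ ∀ a b, ψ (tp a b) = φ a b
  lmul : B → TB →L[ℂ] TB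
  rmul : B → TB →L[ℂ] TB
  lmul_tp : ∀ a b c, lmul a (tp b c) = tp (a * b) c
  rmul_tp : ∀ a b c, rmul a (tp b c) = tp b (c * a)
  ω : TB →L[ℂ] B
  ω_tp : ∀ a b, ω (tp a b) = a * b

/-- A Banach algebra `B` is biprojective if the multiplication map
`ω : B ⊗̂ B → B` has a bounded right inverse which is a `B`-bimodule homomorphism. -/
def TensorSquareSetting.Biprojective {B : Type u} {TB : Type v}
    [NonUnitalNormedRing B] [NormedSpace ℂ B] [CompleteSpace B]
    [NonUnitalNormedRing TB] [NormedSpace ℂ TB] [CompleteSpace TB]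
    (ts : TensorSquareSetting B TB) : Prop :=
  ∃ ρ : B →L[ℂ] TB,
    (∀ a b, ρ (a * b) = ts.lmul a (ρ b)) ∧
    (∀ a b, ρ (b * a) = ts.rmul a (ρ b)) ∧
    (∀ a, ts.ω (ρ a) = a)

/-- A Banach algebra `B` is biflat if the adjoint `ω* : B* → (B ⊗̂ B)*` of the multiplication
map has a bounded left inverse which is a `B`-bimodule homomorphism (for the dual actions
`a · f = f(· a)` and `f · a = f(a ·)`). -/
def TensorSquareSetting.Biflat {B : Type u} {TB : Type v}
    [NonUnitalNormedRing B] [NormedSpace ℂ B] [CompleteSpace B]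
    [NonUnitalNormedRing TB] [NormedSpace ℂ TB] [CompleteSpace TB]
    [IsScalarTower ℂ B B] [SMulCommClass ℂ B B]
    (ts : TensorSquareSetting B TB) : Prop :=
  ∃ θ : (TB →L[ℂ] ℂ) →L[ℂ] (B →L[ℂ] ℂ),
    (∀ (a : B) (f : TB →L[ℂ] ℂ),
      θ (f.comp (ts.rmul a)) = (θ f).comp ((ContinuousLinearMap.mul ℂ B).flip a)) ∧
    (∀ (a : B) (f : TB →L[ℂ] ℂ),
      θ (f.comp (ts.lmul a)) = (θ f).comp (ContinuousLinearMap.mul ℂ B a)) ∧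
    (∀ g : B →L[ℂ] ℂ, θ (g.comp ts.ω) = g)

/-- Compatible bounded bimodule actions of a Banach algebra `𝔄` on a Banach algebra `𝒜`:
`lsmul α a = α · a` and `rsmul α a = a · α`, with `α · (a b) = (α · a) b` and
`(a b) · α = a (b · α)`. -/
structure ActionSetting (𝔄 : Type u₁) (𝒜 : Type u)
    [NonUnitalNormedRing 𝔄] [NormedSpace ℂ 𝔄] [CompleteSpace 𝔄]
    [NonUnitalNormedRing 𝒜] [NormedSpace ℂ 𝒜] [CompleteSpace 𝒜] where
  lsmul : 𝔄 → 𝒜 →L[ℂ] 𝒜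
  rsmul : 𝔄 → 𝒜 →L[ℂ] 𝒜
  lsmul_add : ∀ α β, lsmul (α + β) = lsmul α + lsmul β
  lsmul_smulc : ∀ (z : ℂ) α, lsmul (z • α) = z • lsmul α
  rsmul_add : ∀ α β, rsmul (α + β) = rsmul α + rsmul β
  rsmul_smulc : ∀ (z : ℂ) α, rsmul (z • α) = z • rsmul α
  lsmul_bound : ∃ C : ℝ, ∀ α, ‖lsmul α‖ ≤ C * ‖α‖
  rsmul_bound : ∃ C : ℝ, ∀ α, ‖rsmul α‖ ≤ C * ‖α‖
  lsmul_mulA : ∀ α β a, lsmul (α * β) a = lsmul α (lsmul β a)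
  rsmul_mulA : ∀ α β a, rsmul (α * β) a = rsmul β (rsmul α a)
  lsmul_rsmul : ∀ α β a, rsmul β (lsmul α a) = lsmul α (rsmul β a)
  lsmul_compat : ∀ α a b, lsmul α (a * b) = lsmul α a * b
  rsmul_compat : ∀ α a b, rsmul α (a * b) = a * rsmul α b

/-- The full setting of the paper: `𝒜` is a Banach algebra with compatible `𝔄`-actions,
`T = 𝒜 ⊗̂ 𝒜` is its projective tensor square carrying the induced `𝔄`-actions
(`tlsmul α (a ⊗ b) = (α·a) ⊗ b`, `trsmul α (a ⊗ b) = a ⊗ (b·α)`), `I ⊆ T` is the closed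
ideal generated by the elements `α·a ⊗ b - a ⊗ b·α`, `J ⊆ 𝒜` is the closed ideal generated
by `ω(I)`, and the induced bounded operators on the quotient Banach spaces
`T ⧸ I = 𝒜 ⊗̂_𝔄 𝒜` and `𝒜 ⧸ J` are recorded: `qω` is the induced multiplication map `ω̃`,
`qlsmul/qrsmul` (resp. `qtlsmul/qtrsmul`) are the induced `𝔄`-actions on `𝒜 ⧸ J`
(resp. `T ⧸ I`), and `qmulL/qmulR` (resp. `qlmul/qrmul`) are the induced `𝒜`- (hence
`𝒜/J`-) bimodule actions on `𝒜 ⧸ J` (resp. `T ⧸ I`). -/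
structure ModuleSetting (𝔄 : Type u₁) (𝒜 : Type u) (T : Type v)
    [NonUnitalNormedRing 𝔄] [NormedSpace ℂ 𝔄] [CompleteSpace 𝔄]
    [NonUnitalNormedRing 𝒜] [NormedSpace ℂ 𝒜] [CompleteSpace 𝒜]
    [NonUnitalNormedRing T] [NormedSpace ℂ T] [CompleteSpace T] extends
    TensorSquareSetting 𝒜 T, ActionSetting 𝔄 𝒜 where
  tlsmul : 𝔄 → T →L[ℂ] T
  trsmul : 𝔄 → T →L[ℂ] T
  tlsmul_tp : ∀ α a b, tlsmul α (tp a b) = tp (lsmul α a) b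
  trsmul_tp : ∀ α a b, trsmul α (tp a b) = tp a (rsmul α b)
  I : Submodule ℂ T
  J : Submodule ℂ 𝒜
  hI : I = closedIdealGen
    {x : T | ∃ (α : 𝔄) (a b : 𝒜), x = tlsmul α (tp a b) - trsmul α (tp a b)}
  hJ : J = closedIdealGen (ω '' I)
  qω : (T ⧸ I) →L[ℂ] (𝒜 ⧸ J)
  qω_mk : ∀ t, qω (Submodule.Quotient.mk t) = Submodule.Quotient.mk (ω t)
  qlsmul : 𝔄 → (𝒜 ⧸ J) →L[ℂ] (𝒜 ⧸ J)
  qrsmul : 𝔄 → (𝒜 ⧸ J) →L[ℂ] (𝒜 ⧸ J)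
  qlsmul_mk : ∀ α a, qlsmul α (Submodule.Quotient.mk a) = Submodule.Quotient.mk (lsmul α a)
  qrsmul_mk : ∀ α a, qrsmul α (Submodule.Quotient.mk a) = Submodule.Quotient.mk (rsmul α a)
  qmulL : 𝒜 → (𝒜 ⧸ J) →L[ℂ] (𝒜 ⧸ J)
  qmulR : 𝒜 → (𝒜 ⧸ J) →L[ℂ] (𝒜 ⧸ J)
  qmulL_mk : ∀ a b, qmulL a (Submodule.Quotient.mk b) = Submodule.Quotient.mk (a * b)
  qmulR_mk : ∀ a b, qmulR a (Submodule.Quotient.mk b) = Submodule.Quotient.mk (b * a)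
  qtlsmul : 𝔄 → (T ⧸ I) →L[ℂ] (T ⧸ I)
  qtrsmul : 𝔄 → (T ⧸ I) →L[ℂ] (T ⧸ I)
  qtlsmul_mk : ∀ α t, qtlsmul α (Submodule.Quotient.mk t) = Submodule.Quotient.mk (tlsmul α t)
  qtrsmul_mk : ∀ α t, qtrsmul α (Submodule.Quotient.mk t) = Submodule.Quotient.mk (trsmul α t)
  qlmul : 𝒜 → (T ⧸ I) →L[ℂ] (T ⧸ I)
  qrmul : 𝒜 → (T ⧸ I) →L[ℂ] (T ⧸ I)
  qlmul_mk : ∀ a t, qlmul a (Submodule.Quotient.mk t) = Submodule.Quotient.mk (lmul a t)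
  qrmul_mk : ∀ a t, qrmul a (Submodule.Quotient.mk t) = Submodule.Quotient.mk (rmul a t)

namespace ModuleSetting

variable {𝔄 : Type u₁} {𝒜 : Type u} {T : Type v}
    [NonUnitalNormedRing 𝔄] [NormedSpace ℂ 𝔄] [CompleteSpace 𝔄]
    [NonUnitalNormedRing 𝒜] [NormedSpace ℂ 𝒜] [CompleteSpace 𝒜]
    [NonUnitalNormedRing T] [NormedSpace ℂ T] [CompleteSpace T]

/-- `𝒜` is module biprojective (as an `𝔄`-module) if the induced multiplication map
`ω̃ : 𝒜 ⊗̂_𝔄 𝒜 → 𝒜 ⧸ J` has a bounded right inverse which is an `𝒜/J`-`𝔄`-module morphism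
(a bounded additive map commuting with the `𝔄`-actions and the `𝒜/J`-bimodule actions). -/
def ModuleBiprojective (S : ModuleSetting 𝔄 𝒜 T) : Prop :=
  ∃ ρ : (𝒜 ⧸ S.J) → (T ⧸ S.I),
    (∀ x y, ρ (x + y) = ρ x + ρ y) ∧
    (∃ C : ℝ, ∀ x, ‖ρ x‖ ≤ C * ‖x‖) ∧
    (∀ α x, ρ (S.qlsmul α x) = S.qtlsmul α (ρ x)) ∧
    (∀ α x, ρ (S.qrsmul α x) = S.qtrsmul α (ρ x)) ∧
    (∀ a x, ρ (S.qmulL a x) = S.qlmul a (ρ x)) ∧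
    (∀ a x, ρ (S.qmulR a x) = S.qrmul a (ρ x)) ∧
    (∀ x, S.qω (ρ x) = x)

/-- `𝒜` is module biflat (as an `𝔄`-module) if the adjoint
`ω̃* : (𝒜 ⧸ J)* → (𝒜 ⊗̂_𝔄 𝒜)*` has a bounded left inverse which is an `𝒜/J`-`𝔄`-module
morphism (for the dual actions). -/
def ModuleBiflat (S : ModuleSetting 𝔄 𝒜 T) : Prop :=
  ∃ θ : ((T ⧸ S.I) →L[ℂ] ℂ) → ((𝒜 ⧸ S.J) →L[ℂ] ℂ),
    (∀ f g, θ (f + g) = θ f + θ g) ∧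
    (∃ C : ℝ, ∀ f, ‖θ f‖ ≤ C * ‖f‖) ∧
    (∀ α f, θ (f.comp (S.qtrsmul α)) = (θ f).comp (S.qrsmul α)) ∧
    (∀ α f, θ (f.comp (S.qtlsmul α)) = (θ f).comp (S.qlsmul α)) ∧
    (∀ a f, θ (f.comp (S.qrmul a)) = (θ f).comp (S.qmulR a)) ∧
    (∀ a f, θ (f.comp (S.qlmul a)) = (θ f).comp (S.qmulL a)) ∧
    (∀ g : (𝒜 ⧸ S.J) →L[ℂ] ℂ, θ (g.comp S.qω) = g)

/-- `𝔄` acts trivially on `𝒜` from the left, via the continuous functional `f`: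
`α · a = f(α) a`. -/
def TrivialLeftAction (S : ModuleSetting 𝔄 𝒜 T) (f : 𝔄 →L[ℂ] ℂ) : Prop :=
  ∀ α a, S.lsmul α a = f α • a

/-- The quotient algebra `𝒜 ⧸ J` has a left identity `e + J`. -/
def HasLeftIdentity (S : ModuleSetting 𝔄 𝒜 T) : Prop :=
  ∃ e : 𝒜, ∀ x : 𝒜 ⧸ S.J, S.qmulL e x = x

/-- The quotient algebra `𝒜 ⧸ J` has an identity `e + J`. -/
def HasIdentity (S : ModuleSetting 𝔄 𝒜 T) : Prop :=
  ∃ e : 𝒜, ∀ x : 𝒜 ⧸ S.J, S.qmulL e x = x ∧ S.qmulR e x = x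

/-- `𝔄` has a bounded approximate identity for `𝒜`: a bounded net `(α_j)` in `𝔄` with
`‖α_j · a - a‖ → 0` and `‖a · α_j - a‖ → 0` for every `a ∈ 𝒜`. -/
def HasBoundedApproximateIdentityFor (S : ModuleSetting 𝔄 𝒜 T) : Prop :=
  ∃ C : ℝ, 0 < C ∧ ∀ ε : ℝ, 0 < ε → ∀ F : Finset 𝒜, ∃ α : 𝔄, ‖α‖ ≤ C ∧
    ∀ a ∈ F, ‖S.lsmul α a - a‖ < ε ∧ ‖S.rsmul α a - a‖ < ε

/-- The quotient algebra `𝒜 ⧸ J` has a bounded approximate identity. -/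
def QuotientHasBoundedApproximateIdentity (S : ModuleSetting 𝔄 𝒜 T) : Prop :=
  ∃ C : ℝ, 0 < C ∧ ∀ ε : ℝ, 0 < ε → ∀ F : Finset (𝒜 ⧸ S.J), ∃ e : 𝒜,
    ‖(Submodule.Quotient.mk e : 𝒜 ⧸ S.J)‖ ≤ C ∧
    ∀ x ∈ F, ‖S.qmulL e x - x‖ < ε ∧ ‖S.qmulR e x - x‖ < ε

/-- `𝒜 ⧸ J` is a commutative `𝔄`-module. -/
def QuotientCommutative (S : ModuleSetting 𝔄 𝒜 T) : Prop :=
  ∀ (α : 𝔄) (x : 𝒜 ⧸ S.J), S.qlsmul α x = S.qrsmul α x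

end ModuleSetting

/-- `δ : S → A` exhibits the Banach algebra `A` as the semigroup algebra `ℓ¹(S)` of the
discrete semigroup `S`: the point masses `δ s` multiply via convolution
(`δ s * δ t = δ (s t)`), finite linear combinations of point masses are isometrically
`ℓ¹`-normed, and their span is dense. -/
structure IsL1Algebra (S : Type u₂) [Semigroup S] (A : Type u)
    [NonUnitalNormedRing A] [NormedSpace ℂ A] [CompleteSpace A] (δ : S → A) : Prop where
  delta_mul : ∀ s t : S, δ s * δ t = δ (s * t)
  norm_combo : ∀ c : S →₀ ℂ, ‖c.sum fun s z => z • δ s‖ = c.sum fun _ z => ‖z‖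
  dense_span : Dense ((Submodule.span ℂ (Set.range δ) : Submodule ℂ A) : Set A)

/-- `S` is an inverse semigroup: every element has a unique generalized inverse. -/
def IsInverseSemigroup (S : Type u₂) [Semigroup S] : Prop :=
  ∀ s : S, ∃! t : S, s * t * s = s ∧ t * s * t = t

/-- The set of idempotents of `S` is upward directed: for all idempotents `e, f` there is
an idempotent `g` with `e g = e` and `f g = f`. -/
def UpwardDirectedIdempotents (S : Type u₂) [Semigroup S] : Prop :=
  ∀ e f : S, e * e = e → f * f = f → ∃ g : S, g * g = g ∧ e * g = e ∧ f * g = f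

/-- A discrete semigroup `S` is amenable if there is a mean `m` on `ℓ^∞(S)` (a functional
with `‖m‖ = m(1) = 1`) which is both left and right invariant under translations. -/
def AmenableSemigroup (S : Type u₂) [Semigroup S] [TopologicalSpace S] [DiscreteTopology S] :
    Prop :=
  ∃ m : BoundedContinuousFunction S ℂ →L[ℂ] ℂ, ‖m‖ = 1 ∧ m 1 = 1 ∧
    ∀ (a : S) (f : BoundedContinuousFunction S ℂ),
      m (f.compContinuous ⟨fun s => a * s, continuous_of_discreteTopology⟩) = m f ∧
      m (f.compContinuous ⟨fun s => s * a, continuous_of_discreteTopology⟩) = m f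
/-- The semigroup `(ℕ, ∨)` of natural numbers with the maximum operation
`m ∨ n = max m n`; every element is idempotent. -/
def NatMax : Type := ℕ

/-- The identity map `NatMax → ℕ`. -/
def NatMax.toNat : NatMax → ℕ := fun n => n

/-- The identity map `ℕ → NatMax`. -/
def NatMax.ofNat : ℕ → NatMax := fun n => n

instance : Semigroup NatMax where
  mul a b := NatMax.ofNat (max a.toNat b.toNat)
  mul_assoc a b c := congrArg NatMax.ofNat (max_assoc a.toNat b.toNat c.toNat)

theorem NatMax.mul_def (a b : NatMax) : a * b = NatMax.ofNat (max a.toNat b.toNat) := rfl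
/-- The bicyclic inverse semigroup `𝒞 = {aᵐbⁿ : m, n ≥ 0}`, realized as pairs of natural
numbers `⟨m, n⟩ ↔ aᵐbⁿ` with multiplication
`(aᵐbⁿ)(aᵖb^q) = a^(m + (p ∸ n)) b^(q + (n ∸ p))` and involution `(aᵐbⁿ)* = aⁿbᵐ`.
Its idempotents are the elements `aⁿbⁿ = ⟨n, n⟩`. -/
structure Bicyclic where
  /-- the exponent of `a` -/
  m : ℕ
  /-- the exponent of `b` -/
  n : ℕ

instance : Mul Bicyclic :=
  ⟨fun x y => ⟨x.m + (y.m - x.n), y.n + (x.n - y.m)⟩⟩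

theorem Bicyclic.mul_def (x y : Bicyclic) :
    x * y = ⟨x.m + (y.m - x.n), y.n + (x.n - y.m)⟩ := rfl

instance : Semigroup Bicyclic where
  mul_assoc x y z := by
    simp only [Bicyclic.mul_def, Bicyclic.mk.injEq]
    omega

/-- The involution of the bicyclic semigroup: `(aᵐbⁿ)* = aⁿbᵐ`. -/
def Bicyclic.star (x : Bicyclic) : Bicyclic := ⟨x.n, x.m⟩

/-- The embedding of the idempotent semilattice `(ℕ, ∨)` onto the idempotents
`aⁿbⁿ` of the bicyclic semigroup. -/
def bicyclicIdem : NatMax →ₙ* Bicyclic where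
  toFun e := ⟨e.toNat, e.toNat⟩
  map_mul' e f := by
    simp only [NatMax.mul_def, Bicyclic.mul_def, Bicyclic.mk.injEq]
    constructor <;> (show max e.toNat f.toNat = _) <;> omega

open Filter in
/-- The generalized limit of a bounded sequence: the limit of its Cesàro means along a free
ultrafilter. -/
def banachLim (c : ℕ → ℂ) : ℂ :=
  limUnder (hyperfilter ℕ : Filter ℕ) fun N => (∑ m ∈ Finset.range N, c m) / (N : ℂ)

section BanachLim

open Filter

theorem norm_cesaro_le {c : ℕ → ℂ} {C : ℝ} (hc : ∀ n, ‖c n‖ ≤ C) (N : ℕ) :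
    ‖(∑ m ∈ Finset.range N, c m) / (N : ℂ)‖ ≤ C := by
  have hC : 0 ≤ C := (norm_nonneg _).trans (hc 0)
  rw [norm_div, Complex.norm_natCast]
  refine div_le_of_le_mul₀ (Nat.cast_nonneg _) hC ?_
  refine (norm_sum_le _ _).trans ((Finset.sum_le_sum fun m _ => hc m).trans ?_)
  simp [mul_comm]

theorem tendsto_banachLim {c : ℕ → ℂ} {C : ℝ} (hc : ∀ n, ‖c n‖ ≤ C) :
    Tendsto (fun N : ℕ => (∑ m ∈ Finset.range N, c m) / (N : ℂ)) (hyperfilter ℕ)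
      (𝓝 (banachLim c)) := by
  obtain ⟨x, -, hx⟩ := (isCompact_closedBall (0 : ℂ) C).ultrafilter_le_nhds
    ((hyperfilter ℕ).map fun N : ℕ => (∑ m ∈ Finset.range N, c m) / (N : ℂ))
    (by
      rw [le_principal_iff]
      refine Filter.mem_map.2 (univ_mem' fun N => ?_)
      simpa using norm_cesaro_le hc N)
  exact tendsto_nhds_limUnder ⟨x, hx⟩

theorem norm_banachLim_le {c : ℕ → ℂ} {C : ℝ} (hc : ∀ n, ‖c n‖ ≤ C) : ‖banachLim c‖ ≤ C :=
  le_of_tendsto (tendsto_banachLim hc).norm (Eventually.of_forall (norm_cesaro_le hc))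

theorem banachLim_add {c d : ℕ → ℂ} {C D : ℝ} (hc : ∀ n, ‖c n‖ ≤ C) (hd : ∀ n, ‖d n‖ ≤ D) :
    banachLim (fun n => c n + d n) = banachLim c + banachLim d := by
  refine tendsto_nhds_unique (tendsto_banachLim (C := C + D)
    fun n => (norm_add_le _ _).trans (add_le_add (hc n) (hd n))) ?_
  refine ((tendsto_banachLim hc).add (tendsto_banachLim hd)).congr fun N => ?_
  rw [Finset.sum_add_distrib, add_div]

theorem banachLim_smul {c : ℕ → ℂ} {C : ℝ} (hc : ∀ n, ‖c n‖ ≤ C) (z : ℂ) :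
    banachLim (fun n => z * c n) = z * banachLim c := by
  refine tendsto_nhds_unique (tendsto_banachLim (C := ‖z‖ * C)
    fun n => (norm_mul_le _ _).trans (mul_le_mul_of_nonneg_left (hc n) (norm_nonneg _))) ?_
  refine ((tendsto_banachLim hc).const_mul z).congr fun N => ?_
  rw [← Finset.mul_sum, mul_div_assoc]

theorem banachLim_const (z : ℂ) : banachLim (fun _ => z) = z := by
  refine tendsto_nhds_unique (tendsto_banachLim (C := ‖z‖) fun _ => le_rfl) ?_
  refine Tendsto.mono_left ?_ Nat.hyperfilter_le_atTop
  refine tendsto_const_nhds.congr' ?_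
  filter_upwards [eventually_ne_atTop 0] with N hN
  have : (N : ℂ) ≠ 0 := Nat.cast_ne_zero.2 hN
  simp [this]

theorem banachLim_succ {c : ℕ → ℂ} {C : ℝ} (hc : ∀ n, ‖c n‖ ≤ C) :
    banachLim (fun n => c (n + 1)) = banachLim c := by
  refine tendsto_nhds_unique (tendsto_banachLim (C := C) fun n => hc _) ?_
  have h0 : Tendsto (fun N : ℕ => (c N - c 0) / (N : ℂ)) (hyperfilter ℕ) (𝓝 0) := by
    refine Tendsto.mono_left ?_ Nat.hyperfilter_le_atTop
    refine squeeze_zero_norm (a := fun N : ℕ => (C + C) / (N : ℝ)) (fun N => ?_)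
      (tendsto_const_div_atTop_nhds_zero_nat _)
    rw [norm_div, Complex.norm_natCast]
    gcongr
    exact (norm_sub_le _ _).trans (add_le_add (hc _) (hc _))
  have := (tendsto_banachLim hc).add h0
  rw [add_zero] at this
  refine this.congr fun N => ?_
  rw [← add_div]
  congr 1
  have := Finset.sum_range_succ c N
  rw [Finset.sum_range_succ'] at this
  linear_combination -this

theorem banachLim_shift {c : ℕ → ℂ} {C : ℝ} (hc : ∀ n, ‖c n‖ ≤ C) (k : ℕ) :
    banachLim (fun n => c (n + k)) = banachLim c := by
  induction k with
  | zero => rfl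
  | succ k ih =>
    rw [← ih, ← banachLim_succ (c := fun n => c (n + k)) (C := C) fun n => hc _]
    congr 1
    funext n
    congr 1
    omega

/-- The pointwise generalized limit of a bounded sequence of functionals. -/
theorem exists_banachLim_functional {X : Type*} [SeminormedAddCommGroup X] [NormedSpace ℂ X]
    (g : ℕ → X →L[ℂ] ℂ) {C : ℝ} (hC : 0 ≤ C) (hg : ∀ m x, ‖g m x‖ ≤ C * ‖x‖) :
    ∃ G : X →L[ℂ] ℂ, ‖G‖ ≤ C ∧ ∀ x, G x = banachLim fun m => g m x :=
  ⟨LinearMap.mkContinuous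
    { toFun := fun x => banachLim fun m => g m x
      map_add' := fun x y => by
        rw [← banachLim_add (fun m => hg m x) fun m => hg m y]
        simp only [map_add]
      map_smul' := fun z x => by
        rw [RingHom.id_apply, smul_eq_mul, ← banachLim_smul fun m => hg m x]
        simp only [map_smul, smul_eq_mul] } C fun x => norm_banachLim_le fun m => hg m x,
    LinearMap.mkContinuous_norm_le _ hC _, fun _ => rfl⟩

end BanachLim

theorem Submodule.mem_of_dense_span {X : Type*} [NormedAddCommGroup X] [NormedSpace ℂ X]
    {s : Set X} (hs : Dense ((Submodule.span ℂ s : Submodule ℂ X) : Set X))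
    {p : Submodule ℂ X} (hp : IsClosed (p : Set X)) (h : s ⊆ p) (x : X) : x ∈ p := by
  have h1 : closure ((Submodule.span ℂ s : Submodule ℂ X) : Set X) ⊆ p :=
    hp.closure_subset_iff.2 (Submodule.span_le.2 h)
  exact h1 (hs x)

/-- A uniformly bounded sequence of functionals tending to zero on a set with dense span tends
to zero pointwise. -/
theorem tendsto_zero_of_dense_span {X : Type*} [NormedAddCommGroup X] [NormedSpace ℂ X]
    {s : Set X} (hs : Dense ((Submodule.span ℂ s : Submodule ℂ X) : Set X))
    (D : ℕ → X →L[ℂ] ℂ) {C : ℝ} (hC : ∀ q, ‖D q‖ ≤ C)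
    (h : ∀ x ∈ s, Filter.Tendsto (fun q => D q x) Filter.atTop (𝓝 0)) (x : X) :
    Filter.Tendsto (fun q => D q x) Filter.atTop (𝓝 0) := by
  let p : Submodule ℂ X :=
    { carrier := {x | Filter.Tendsto (fun q => D q x) Filter.atTop (𝓝 0)}
      add_mem' := fun {x y} hx hy => by simpa using hx.add hy
      zero_mem' := by simp
      smul_mem' := fun z x hx => by simpa using hx.const_mul z }
  refine Submodule.mem_of_dense_span hs (p := p) ?_ h x
  have hC0 : 0 ≤ C := (norm_nonneg _).trans (hC 0)
  refine isClosed_of_closure_subset fun x hx => ?_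
  change Filter.Tendsto (fun q => D q x) Filter.atTop (𝓝 0)
  rw [Metric.tendsto_atTop]
  intro ε hε
  obtain ⟨y, hy, hxy⟩ := Metric.mem_closure_iff.1 hx (ε / (2 * (C + 1))) (by positivity)
  obtain ⟨N, hN⟩ := Metric.tendsto_atTop.1 (show Filter.Tendsto (fun q => D q y) Filter.atTop
    (𝓝 0) from hy) (ε / 2) (by positivity)
  refine ⟨N, fun n hn => ?_⟩
  have h1 := hN n hn
  rw [dist_zero_right] at h1 ⊢
  have h2 : ‖D n (x - y)‖ ≤ C * (ε / (2 * (C + 1))) := by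
    refine (D n).le_of_opNorm_le_of_le (hC n) ?_
    rw [← dist_eq_norm]
    exact hxy.le
  have h3 : C * (ε / (2 * (C + 1))) ≤ ε / 2 := by
    rw [← mul_div_assoc, div_le_div_iff₀ (by positivity) (by positivity)]
    nlinarith
  have h4 : D n x = D n (x - y) + D n y := by simp
  rw [h4]
  have := norm_add_le (D n (x - y)) (D n y)
  linarith

/-- If a family of functionals is stable under translation by a set with dense span and vanishes
on `s`, then it vanishes on the closed ideal generated by `s`. -/
theorem eq_zero_of_mem_closedIdealGen {R : Type*} [NonUnitalNormedRing R] [NormedSpace ℂ R]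
    [IsScalarTower ℂ R R] [SMulCommClass ℂ R R] {d : Set R}
    (hd : Dense ((Submodule.span ℂ d : Submodule ℂ R) : Set R)) {Ψ : Set (R →L[ℂ] ℂ)}
    (hl : ∀ ψ ∈ Ψ, ∀ y ∈ d, ψ.comp (ContinuousLinearMap.mul ℂ R y) ∈ Ψ)
    (hr : ∀ ψ ∈ Ψ, ∀ y ∈ d, ψ.comp ((ContinuousLinearMap.mul ℂ R).flip y) ∈ Ψ)
    {s : Set R} (hs : ∀ ψ ∈ Ψ, ∀ x ∈ s, ψ x = 0) {x : R} (hx : x ∈ closedIdealGen s)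
    {ψ : R →L[ℂ] ℂ} (hψ : ψ ∈ Ψ) : ψ x = 0 := by
  let p : Submodule ℂ R := ⨅ ψ ∈ Ψ, LinearMap.ker (ψ : R →ₗ[ℂ] ℂ)
  have mem_p : ∀ y, y ∈ p ↔ ∀ ψ ∈ Ψ, ψ y = 0 := fun y => by simp [p]
  have hp : IsClosed (p : Set R) := by
    have : (p : Set R) = ⋂ ψ ∈ Ψ, {y | ψ y = 0} := by
      ext y
      simp [mem_p]
    rw [this]
    exact isClosed_biInter fun ψ _ => isClosed_eq ψ.continuous continuous_const
  have hle : closedIdealGen s ≤ p := by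
    refine sInf_le ⟨fun y hy => (mem_p y).2 fun ψ hψ => hs ψ hψ y hy, hp, fun a ha y => ⟨?_, ?_⟩⟩
    · refine Submodule.mem_of_dense_span hd
        (p := p.comap (ContinuousLinearMap.mul ℂ R a : R →ₗ[ℂ] R))
        (hp.preimage (ContinuousLinearMap.mul ℂ R a).continuous) (fun y hy => ?_) y
      exact (mem_p _).2 fun ψ hψ => (mem_p a).1 ha _ (hr ψ hψ y hy)
    · refine Submodule.mem_of_dense_span hd
        (p := p.comap ((ContinuousLinearMap.mul ℂ R).flip a : R →ₗ[ℂ] R))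
        (hp.preimage ((ContinuousLinearMap.mul ℂ R).flip a).continuous) (fun y hy => ?_) y
      exact (mem_p _).2 fun ψ hψ => (mem_p a).1 ha _ (hl ψ hψ y hy)
  exact (mem_p x).1 (hle hx) ψ hψ

theorem subset_closedIdealGen {R : Type*} [NonUnitalNormedRing R] [NormedSpace ℂ R] (s : Set R) :
    s ⊆ closedIdealGen s := fun _ hx =>
  (Submodule.mem_sInf).2 fun _ hp => hp.1 hx

namespace IsL1Algebra

variable {S : Type*} [Semigroup S] {A : Type*} [NonUnitalNormedRing A] [NormedSpace ℂ A]
  [CompleteSpace A] {δ : S → A}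

theorem norm_delta (hA : IsL1Algebra S A δ) (s : S) : ‖δ s‖ = 1 := by
  simpa using hA.norm_combo (Finsupp.single s 1)

/-- Every function on `S` bounded by one extends to a contractive functional on `ℓ¹(S)`. -/
theorem exists_functional (hA : IsL1Algebra S A δ) (c : S → ℂ) (hc : ∀ s, ‖c s‖ ≤ 1) :
    ∃ g : A →L[ℂ] ℂ, ‖g‖ ≤ 1 ∧ ∀ s, g (δ s) = c s := by
  have hnorm : ∀ x : S →₀ ℂ, ‖Finsupp.linearCombination ℂ δ x‖ = x.sum fun _ z => ‖z‖ :=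
    fun x => by rw [Finsupp.linearCombination_apply, hA.norm_combo]
  have hinj : Function.Injective (Finsupp.linearCombination ℂ δ) := by
    rw [injective_iff_map_eq_zero]
    intro x hx
    have h := hnorm x
    rw [hx, norm_zero, Finsupp.sum, eq_comm, Finset.sum_eq_zero_iff_of_nonneg
      fun _ _ => norm_nonneg _] at h
    ext s
    by_contra hs
    exact hs (norm_eq_zero.1 (h s (Finsupp.mem_support_iff.2 hs)))
  let e := LinearEquiv.ofInjective (Finsupp.linearCombination ℂ δ) hinj
  have he : ∀ y, ((e y : LinearMap.range (Finsupp.linearCombination ℂ δ)) : A) =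
    Finsupp.linearCombination ℂ δ y := fun y => rfl
  let F : LinearMap.range (Finsupp.linearCombination ℂ δ) →L[ℂ] ℂ :=
    ((Finsupp.linearCombination ℂ c).comp (e.symm : _ →ₗ[ℂ] (S →₀ ℂ))).mkContinuous 1 (by
      intro x
      obtain ⟨y, rfl⟩ := e.surjective x
      rw [one_mul, Submodule.coe_norm, he, hnorm]
      simp only [LinearMap.comp_apply, LinearEquiv.coe_coe, LinearEquiv.symm_apply_apply]
      rw [Finsupp.linearCombination_apply]
      refine (norm_sum_le _ _).trans (Finset.sum_le_sum fun s _ => ?_)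
      rw [norm_smul]
      exact mul_le_of_le_one_right (norm_nonneg _) (hc s))
  obtain ⟨g, hg, hgn⟩ := exists_extension_norm_eq _ F
  refine ⟨g, hgn ▸ LinearMap.mkContinuous_norm_le _ zero_le_one _, fun s => ?_⟩
  have h1 : ((e (Finsupp.single s 1) : LinearMap.range (Finsupp.linearCombination ℂ δ)) : A) =
      δ s := by rw [he]; simp
  rw [← h1, hg]
  simp [F]

end IsL1Algebra

namespace TensorSquareSetting

variable {B : Type u} {TB : Type v}
    [NonUnitalNormedRing B] [NormedSpace ℂ B] [CompleteSpace B]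
    [NonUnitalNormedRing TB] [NormedSpace ℂ TB] [CompleteSpace TB]

/-- The canonical bilinear map `B × B → B ⊗̂ B` as a continuous bilinear map. -/
def tpL (ts : TensorSquareSetting.{u, v, w} B TB) :
    B →L[ℂ] B →L[ℂ] TB :=
  LinearMap.mkContinuous₂ (LinearMap.mk₂ ℂ ts.tp ts.tp_add_left ts.tp_smul_left ts.tp_add_right
    ts.tp_smul_right) 1 fun a b => by simpa using ts.tp_norm a b

theorem isScalarTower (ts : TensorSquareSetting.{u, v, w} B TB) :
    IsScalarTower ℂ B B :=
  ⟨fun z a b => by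
    rw [smul_eq_mul, smul_eq_mul, ← ts.ω_tp, ← ts.ω_tp, ts.tp_smul_left, map_smul]⟩

theorem smulCommClass (ts : TensorSquareSetting.{u, v, w} B TB) :
    SMulCommClass ℂ B B :=
  ⟨fun z a b => by
    rw [smul_eq_mul, smul_eq_mul, ← ts.ω_tp, ← ts.ω_tp, ts.tp_smul_right, map_smul]⟩

theorem induction_tp (ts : TensorSquareSetting.{u, v, w} B TB)
    {P : TB → Prop} (hP : IsClosed {x | P x}) (h0 : P 0)
    (hadd : ∀ x y, P x → P y → P (x + y)) (htp : ∀ a b, P (ts.tp a b)) (x : TB) : P x := by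
  have h1 : closure ((Submodule.span ℂ (Set.range fun p : B × B => ts.tp p.1 p.2) :
      Submodule ℂ TB) : Set TB) ⊆ {x | P x} := by
    refine hP.closure_subset_iff.2 fun y hy => ?_
    replace hy : y ∈ Submodule.span ℂ (Set.range fun p : B × B => ts.tp p.1 p.2) := hy
    induction hy using Submodule.closure_induction with
    | zero => exact h0
    | add x y _ _ hx hy => exact hadd x y hx hy
    | smul_mem z x hx =>
      obtain ⟨p, rfl⟩ := hx
      change P (z • ts.tp p.1 p.2)
      rw [← ts.tp_smul_left]
      exact htp _ _
  exact h1 (ts.tp_dense x)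

theorem isScalarTower_tensor (ts : TensorSquareSetting.{u, v, w} B TB) :
    IsScalarTower ℂ TB TB := by
  have := ts.isScalarTower
  refine ⟨fun z x y => ?_⟩
  simp only [smul_eq_mul]
  refine ts.induction_tp (P := fun x => z • x * y = z • (x * y))
    (isClosed_eq (by fun_prop) (by fun_prop)) (by simp)
    (fun a b ha hb => by rw [smul_add, add_mul, ha, hb, add_mul, smul_add]) (fun a b => ?_) x
  refine ts.induction_tp (P := fun y => z • ts.tp a b * y = z • (ts.tp a b * y))
    (isClosed_eq (by fun_prop) (by fun_prop)) (by simp)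
    (fun a b ha hb => by rw [mul_add, ha, hb, mul_add, smul_add]) (fun c d => ?_) y
  rw [← ts.tp_smul_left, ts.tp_mul, ts.tp_mul, ← ts.tp_smul_left, smul_mul_assoc]

theorem smulCommClass_tensor (ts : TensorSquareSetting.{u, v, w} B TB) :
    SMulCommClass ℂ TB TB := by
  have := ts.smulCommClass
  refine ⟨fun z x y => ?_⟩
  simp only [smul_eq_mul]
  refine ts.induction_tp (P := fun x => z • (x * y) = x * z • y)
    (isClosed_eq (by fun_prop) (by fun_prop)) (by simp)
    (fun a b ha hb => by rw [add_mul, smul_add, ha, hb, add_mul]) (fun a b => ?_) x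
  refine ts.induction_tp (P := fun y => z • (ts.tp a b * y) = ts.tp a b * z • y)
    (isClosed_eq (by fun_prop) (by fun_prop)) (by simp)
    (fun a b ha hb => by rw [mul_add, smul_add, ha, hb, smul_add, mul_add]) (fun c d => ?_) y
  rw [← ts.tp_smul_right, ts.tp_mul, ts.tp_mul, ← ts.tp_smul_right, mul_smul_comm]

/-- The elementary tensors of elements of a set with dense span have dense span. -/
theorem dense_span_tp (ts : TensorSquareSetting.{u, v, w} B TB)
    {s : Set B} (hs : Dense ((Submodule.span ℂ s : Submodule ℂ B) : Set B)) :
    Dense ((Submodule.span ℂ (Set.image2 ts.tp s s) : Submodule ℂ TB) : Set TB) := by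
  let M := (Submodule.span ℂ (Set.image2 ts.tp s s)).topologicalClosure
  have hM : IsClosed (M : Set TB) := Submodule.isClosed_topologicalClosure _
  have h1 : ∀ b ∈ s, ∀ a, ts.tp a b ∈ M := fun b hb a =>
    Submodule.mem_of_dense_span hs (p := M.comap (ts.tpL.flip b : B →ₗ[ℂ] TB))
      (hM.preimage (ts.tpL.flip b).continuous)
      (fun a ha => Submodule.le_topologicalClosure _
        (Submodule.subset_span (Set.mem_image2_of_mem ha hb))) a
  have h2 : ∀ a b, ts.tp a b ∈ M := fun a b =>
    Submodule.mem_of_dense_span hs (p := M.comap (ts.tpL a : B →ₗ[ℂ] TB))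
      (hM.preimage (ts.tpL a).continuous) (fun b hb => h1 b hb a) b
  exact fun x => Submodule.mem_of_dense_span ts.tp_dense (p := M) hM
    (by rintro _ ⟨p, rfl⟩; exact h2 _ _) x

/-- The tensor product of two functionals. -/
theorem exists_functional (ts : TensorSquareSetting.{u, v, w} B TB)
    (g h : B →L[ℂ] ℂ) :
    ∃ ψ : TB →L[ℂ] ℂ, ‖ψ‖ ≤ ‖g‖ * ‖h‖ ∧ ∀ a b, ψ (ts.tp a b) = g a * h b := by
  let E : ULift.{w} ℂ ≃ₗᵢ[ℂ] ℂ := LinearIsometryEquiv.ulift ℂ ℂ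
  let φ : B →L[ℂ] B →L[ℂ] ULift.{w} ℂ :=
    LinearMap.mkContinuous₂ (LinearMap.mk₂ ℂ (fun a b => E.symm (g a * h b))
      (by intros; simp [add_mul]) (by intros; rw [map_smul, smul_mul_assoc, map_smul]) (by intros; simp [mul_add])
      (by intros; rw [map_smul, mul_smul_comm, map_smul])) (‖g‖ * ‖h‖) fun a b => by
        simp only [LinearMap.mk₂_apply, LinearIsometryEquiv.norm_map, norm_mul]
        calc ‖g a‖ * ‖h b‖ ≤ (‖g‖ * ‖a‖) * (‖h‖ * ‖b‖) := by
              gcongr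
              · exact g.le_opNorm a
              · exact h.le_opNorm b
          _ = ‖g‖ * ‖h‖ * ‖a‖ * ‖b‖ := by ring
  obtain ⟨ψ, hψ, hψt⟩ := ts.tp_universal φ
  refine ⟨(E.toContinuousLinearEquiv : ULift.{w} ℂ →L[ℂ] ℂ).comp ψ, ?_, fun a b => ?_⟩
  · refine ContinuousLinearMap.opNorm_le_bound _ (by positivity) fun x => ?_
    have h1 : ‖φ‖ ≤ ‖g‖ * ‖h‖ := LinearMap.mkContinuous₂_norm_le _ (by positivity) _
    calc ‖E (ψ x)‖ = ‖ψ x‖ := E.norm_map _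
      _ ≤ _ := ψ.le_of_opNorm_le (hψ.trans h1) x
  · change E (ψ (ts.tp a b)) = _
    rw [hψt]
    exact E.apply_symm_apply _

end TensorSquareSetting

namespace Bicyclic

theorem mk_mul_mk (a b c d : ℕ) : (⟨a, b⟩ * ⟨c, d⟩ : Bicyclic) = ⟨a + (c - b), d + (b - c)⟩ := rfl

/-- Two elements have the same image in the maximal group image `ℤ` of the bicyclic
semigroup. -/
def SameDegree (s t : Bicyclic) : Prop := s.m + t.n = t.m + s.n

theorem SameDegree.mul {s t s' t' : Bicyclic} (h : SameDegree s t) (h' : SameDegree s' t') :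
    SameDegree (s * s') (t * t') := by
  simp only [SameDegree, mul_def] at *
  omega

theorem SameDegree.refl (s : Bicyclic) : SameDegree s s := rfl

theorem sameDegree_mul_idem (s : Bicyclic) (e : NatMax) :
    SameDegree (s * bicyclicIdem e) s := by
  change s.m + (e.toNat - s.n) + s.n = s.m + (e.toNat + (s.n - e.toNat))
  omega

theorem sameDegree_mul_comm (s t : Bicyclic) : SameDegree (s * t) (t * s) := by
  simp only [SameDegree, mul_def]
  omega

theorem SameDegree.exists_idem {s t : Bicyclic} (h : SameDegree s t) :
    ∃ e : NatMax, s * bicyclicIdem e = t * bicyclicIdem e := by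
  refine ⟨NatMax.ofNat (max s.n t.n), ?_⟩
  change (⟨s.m + (max s.n t.n - s.n), max s.n t.n + (s.n - max s.n t.n)⟩ : Bicyclic) =
    ⟨t.m + (max s.n t.n - t.n), max s.n t.n + (t.n - max s.n t.n)⟩
  simp only [SameDegree] at h
  rw [Bicyclic.mk.injEq]
  omega

end Bicyclic

open Bicyclic

section BicyclicAlgebra

variable {A Ae : Type u} {TA : Type v}
    [NonUnitalNormedRing A] [NormedSpace ℂ A] [CompleteSpace A]
    [NonUnitalNormedRing Ae] [NormedSpace ℂ Ae] [CompleteSpace Ae]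
    [NonUnitalNormedRing TA] [NormedSpace ℂ TA] [CompleteSpace TA]
    {δ : Bicyclic → A} {δE : NatMax → Ae}

theorem ActionSetting.rsmul_eq (AS : ActionSetting Ae A)
    (hA : IsL1Algebra Bicyclic A δ) (hAe : IsL1Algebra NatMax Ae δE) {f : Ae →L[ℂ] ℂ}
    (hf : ∀ e : NatMax, f (δE e) = 1)
    (hr : ∀ (e : NatMax) (s : Bicyclic), AS.rsmul (δE e) (δ s) = δ (s * bicyclicIdem e))
    {ψ : A →L[ℂ] ℂ} (hψ : ∀ s t, SameDegree s t → ψ (δ s) = ψ (δ t)) (α : Ae) (a : A) :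
    ψ (AS.rsmul α a) = f α * ψ a := by
  obtain ⟨C, hC⟩ := AS.rsmul_bound
  let R : Ae →L[ℂ] A →L[ℂ] A := LinearMap.mkContinuous
    { toFun := AS.rsmul, map_add' := AS.rsmul_add, map_smul' := AS.rsmul_smulc } C hC
  have h1 : ∀ s, (ψ.comp (R.flip (δ s))) = (ψ (δ s)) • f := fun s =>
    ContinuousLinearMap.ext_on hAe.dense_span (by
      rintro _ ⟨e, rfl⟩
      change ψ (AS.rsmul (δE e) (δ s)) = ψ (δ s) * f (δE e)
      rw [hr, hf, mul_one]
      exact hψ _ _ (sameDegree_mul_idem s e))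
  have h2 : ψ.comp (AS.rsmul α) = (f α) • ψ :=
    ContinuousLinearMap.ext_on hA.dense_span (by
      rintro _ ⟨s, rfl⟩
      have := congrArg (fun g => g α) (h1 s)
      change ψ (AS.rsmul α (δ s)) = f α * ψ (δ s)
      rw [mul_comm]
      exact this)
  exact congrArg (fun g => g a) h2

namespace ModuleSetting

/-- A functional on the tensor square which only sees the degree in the second variable
vanishes on `I`. -/
theorem eq_zero_of_mem_I (MS : ModuleSetting.{u, u, v, w} Ae A TA)
    (hA : IsL1Algebra Bicyclic A δ) (hAe : IsL1Algebra NatMax Ae δE) {f : Ae →L[ℂ] ℂ}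
    (hf : ∀ e : NatMax, f (δE e) = 1) (htriv : MS.TrivialLeftAction f)
    (hr : ∀ (e : NatMax) (s : Bicyclic), MS.rsmul (δE e) (δ s) = δ (s * bicyclicIdem e))
    {ψ : TA →L[ℂ] ℂ}
    (hψ : ∀ s t t', SameDegree t t' → ψ (MS.tp (δ s) (δ t)) = ψ (MS.tp (δ s) (δ t')))
    {x : TA} (hx : x ∈ MS.I) : ψ x = 0 := by
  have := MS.isScalarTower_tensor
  have := MS.smulCommClass_tensor
  rw [MS.hI] at hx
  refine eq_zero_of_mem_closedIdealGen (MS.dense_span_tp hA.dense_span)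
    (Ψ := {ψ | ∀ s t t', SameDegree t t' → ψ (MS.tp (δ s) (δ t)) = ψ (MS.tp (δ s) (δ t'))})
    ?_ ?_ ?_ hx hψ
  · rintro ψ hψ _ ⟨_, ⟨u, rfl⟩, _, ⟨v, rfl⟩, rfl⟩ s t t' h
    simp only [ContinuousLinearMap.comp_apply, ContinuousLinearMap.mul_apply', MS.tp_mul,
      hA.delta_mul]
    exact hψ _ _ _ ((SameDegree.refl v).mul h)
  · rintro ψ hψ _ ⟨_, ⟨u, rfl⟩, _, ⟨v, rfl⟩, rfl⟩ s t t' h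
    simp only [ContinuousLinearMap.comp_apply, ContinuousLinearMap.flip_apply,
      ContinuousLinearMap.mul_apply', MS.tp_mul, hA.delta_mul]
    exact hψ _ _ _ (h.mul (SameDegree.refl v))
  · rintro ψ hψ _ ⟨α, a, b, rfl⟩
    rw [MS.tlsmul_tp, MS.trsmul_tp, htriv, MS.tp_smul_left, map_sub, map_smul, sub_eq_zero]
    have h1 : (ψ.comp (MS.tpL.flip (MS.rsmul α b))) = (f α) • ψ.comp (MS.tpL.flip b) :=
      ContinuousLinearMap.ext_on hA.dense_span (by
        rintro _ ⟨s, rfl⟩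
        exact MS.toActionSetting.rsmul_eq hA hAe hf hr (ψ := ψ.comp (MS.tpL (δ s)))
          (fun t t' h => hψ s t t' h) α b)
    exact (congrArg (fun g => g a) h1).symm

/-- A functional on the algebra which only sees the degree vanishes on `J`. -/
theorem eq_zero_of_mem_J (MS : ModuleSetting.{u, u, v, w} Ae A TA)
    (hA : IsL1Algebra Bicyclic A δ) (hAe : IsL1Algebra NatMax Ae δE) {f : Ae →L[ℂ] ℂ}
    (hf : ∀ e : NatMax, f (δE e) = 1) (htriv : MS.TrivialLeftAction f)
    (hr : ∀ (e : NatMax) (s : Bicyclic), MS.rsmul (δE e) (δ s) = δ (s * bicyclicIdem e))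
    {ψ : A →L[ℂ] ℂ} (hψ : ∀ s t, SameDegree s t → ψ (δ s) = ψ (δ t))
    {x : A} (hx : x ∈ MS.J) : ψ x = 0 := by
  have := MS.isScalarTower
  have := MS.smulCommClass
  rw [MS.hJ] at hx
  refine eq_zero_of_mem_closedIdealGen hA.dense_span
    (Ψ := {ψ | ∀ s t, SameDegree s t → ψ (δ s) = ψ (δ t)}) ?_ ?_ ?_ hx hψ
  · rintro ψ hψ _ ⟨u, rfl⟩ s t h
    simp only [ContinuousLinearMap.comp_apply, ContinuousLinearMap.mul_apply', hA.delta_mul]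
    exact hψ _ _ ((SameDegree.refl u).mul h)
  · rintro ψ hψ _ ⟨u, rfl⟩ s t h
    simp only [ContinuousLinearMap.comp_apply, ContinuousLinearMap.flip_apply,
      ContinuousLinearMap.mul_apply', hA.delta_mul]
    exact hψ _ _ (h.mul (SameDegree.refl u))
  · rintro ψ hψ _ ⟨y, hy, rfl⟩
    refine MS.eq_zero_of_mem_I hA hAe hf htriv hr (ψ := ψ.comp MS.ω) (fun s t t' h => ?_) hy
    simp only [ContinuousLinearMap.comp_apply, MS.ω_tp, hA.delta_mul]
    exact hψ _ _ ((SameDegree.refl s).mul h)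

theorem tp_sub_tp_mem_I (MS : ModuleSetting.{u, u, v, w} Ae A TA) {f : Ae →L[ℂ] ℂ}
    (hf : ∀ e : NatMax, f (δE e) = 1) (htriv : MS.TrivialLeftAction f)
    (hr : ∀ (e : NatMax) (s : Bicyclic), MS.rsmul (δE e) (δ s) = δ (s * bicyclicIdem e))
    (a : A) (s : Bicyclic) (e : NatMax) :
    MS.tp a (δ s) - MS.tp a (δ (s * bicyclicIdem e)) ∈ MS.I := by
  rw [MS.hI]
  refine subset_closedIdealGen _ ⟨δE e, a, δ s, ?_⟩
  rw [MS.tlsmul_tp, MS.trsmul_tp, htriv, hf, one_smul, hr]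

theorem mk_tp_eq (MS : ModuleSetting.{u, u, v, w} Ae A TA) {f : Ae →L[ℂ] ℂ}
    (hf : ∀ e : NatMax, f (δE e) = 1) (htriv : MS.TrivialLeftAction f)
    (hr : ∀ (e : NatMax) (s : Bicyclic), MS.rsmul (δE e) (δ s) = δ (s * bicyclicIdem e))
    (a : A) {s t : Bicyclic} (h : SameDegree s t) :
    (Submodule.Quotient.mk (MS.tp a (δ s)) : TA ⧸ MS.I) =
      Submodule.Quotient.mk (MS.tp a (δ t)) := by
  obtain ⟨e, he⟩ := h.exists_idem
  rw [(Submodule.Quotient.eq MS.I).2 (MS.tp_sub_tp_mem_I hf htriv hr a s e), he,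
    ← (Submodule.Quotient.eq MS.I).2 (MS.tp_sub_tp_mem_I hf htriv hr a t e)]

theorem mk_delta_eq (MS : ModuleSetting.{u, u, v, w} Ae A TA)
    (hA : IsL1Algebra Bicyclic A δ) {f : Ae →L[ℂ] ℂ}
    (hf : ∀ e : NatMax, f (δE e) = 1) (htriv : MS.TrivialLeftAction f)
    (hr : ∀ (e : NatMax) (s : Bicyclic), MS.rsmul (δE e) (δ s) = δ (s * bicyclicIdem e))
    {s t : Bicyclic} (h : SameDegree s t) :
    (Submodule.Quotient.mk (δ s) : A ⧸ MS.J) = Submodule.Quotient.mk (δ t) := by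
  have h1 := congrArg MS.qω (MS.mk_tp_eq hf htriv hr (δ ⟨0, 0⟩) h)
  rw [MS.qω_mk, MS.qω_mk, MS.ω_tp, MS.ω_tp, hA.delta_mul, hA.delta_mul] at h1
  have h2 : ∀ s : Bicyclic, (⟨0, 0⟩ * s : Bicyclic) = s := fun s => by simp [Bicyclic.mul_def]
  rwa [h2, h2] at h1

theorem not_moduleBiprojective (MS : ModuleSetting.{u, u, v, w} Ae A TA)
    (hA : IsL1Algebra Bicyclic A δ) (hAe : IsL1Algebra NatMax Ae δE) {f : Ae →L[ℂ] ℂ}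
    (hf : ∀ e : NatMax, f (δE e) = 1) (htriv : MS.TrivialLeftAction f)
    (hr : ∀ (e : NatMax) (s : Bicyclic), MS.rsmul (δE e) (δ s) = δ (s * bicyclicIdem e)) :
    ¬ MS.ModuleBiprojective := by
  rintro ⟨ρ, -, -, -, -, hρ, -, hω⟩
  obtain ⟨aug, haugn, haug⟩ := hA.exists_functional (fun _ => 1) (by simp)
  choose h hhn hh using fun q : ℕ =>
    hA.exists_functional (fun s => if s.m < q then 1 else 0) (fun s => by split_ifs <;> simp)
  choose ψ hψn hψ using fun q : ℕ => MS.exists_functional (h q) aug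
  obtain ⟨x, hx⟩ := Submodule.Quotient.mk_surjective _ (ρ (Submodule.Quotient.mk (δ ⟨0, 0⟩)))
  have hψI : ∀ q, ∀ y ∈ MS.I, ψ q y = 0 := fun q y hy =>
    MS.eq_zero_of_mem_I hA hAe hf htriv hr (fun s t t' _ => by simp only [hψ, haug]) hy
  have hdense := MS.dense_span_tp hA.dense_span
  have hzero : ∀ q, ψ q x = 0 := by
    intro q
    have h1 := hρ (δ ⟨q, q⟩) (Submodule.Quotient.mk (δ ⟨0, 0⟩))
    rw [MS.qmulL_mk, hA.delta_mul, MS.mk_delta_eq hA hf htriv hr (t := ⟨0, 0⟩)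
      (by simp [SameDegree, Bicyclic.mul_def]), ← hx, MS.qlmul_mk, Submodule.Quotient.eq] at h1
    have h2 := hψI q _ h1
    have h3 : (ψ q).comp (MS.lmul (δ ⟨q, q⟩)) = 0 :=
      ContinuousLinearMap.ext_on hdense (by
        rintro _ ⟨_, ⟨u, rfl⟩, _, ⟨v, rfl⟩, rfl⟩
        simp only [ContinuousLinearMap.comp_apply, MS.lmul_tp, hψ, hA.delta_mul, hh,
          Bicyclic.mul_def]
        simp)
    have h4 : ψ q (MS.lmul (δ ⟨q, q⟩) x) = 0 := congrArg (fun g => g x) h3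
    rwa [map_sub, h4, sub_zero] at h2
  have hlim := tendsto_zero_of_dense_span hdense (fun q => ψ q - aug.comp MS.ω)
    (C := 1 + ‖aug.comp MS.ω‖) (fun q => (norm_sub_le _ _).trans (by
      gcongr
      exact (hψn q).trans (mul_le_one₀ (hhn q) (norm_nonneg _) haugn))) (by
    rintro _ ⟨_, ⟨u, rfl⟩, _, ⟨v, rfl⟩, rfl⟩
    refine tendsto_const_nhds.congr' ?_
    filter_upwards [Filter.eventually_gt_atTop u.m] with q hq
    simp [hψ, hh, haug, MS.ω_tp, hA.delta_mul, hq]) x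
  have haugx : aug (MS.ω x) = 1 := by
    have h1 := hω (Submodule.Quotient.mk (δ ⟨0, 0⟩))
    rw [← hx, MS.qω_mk, Submodule.Quotient.eq] at h1
    have h2 := MS.eq_zero_of_mem_J hA hAe hf htriv hr (ψ := aug)
      (fun s t _ => by rw [haug, haug]) h1
    rwa [map_sub, haug, sub_eq_zero] at h2
  simp only [sub_apply, ContinuousLinearMap.comp_apply, hzero, haugx] at hlim
  simpa using tendsto_nhds_unique tendsto_const_nhds hlim

theorem norm_mk_tp_le (MS : ModuleSetting.{u, u, v, w} Ae A TA)
    (F : (TA ⧸ MS.I) →L[ℂ] ℂ) (a b : A) :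
    ‖F (Submodule.Quotient.mk (MS.tp a b))‖ ≤ ‖F‖ * (‖a‖ * ‖b‖) :=
  F.le_of_opNorm_le_of_le le_rfl ((Submodule.Quotient.norm_mk_le _ _).trans (MS.tp_norm _ _))

theorem norm_mk_tp_delta_le (MS : ModuleSetting.{u, u, v, w} Ae A TA)
    (hA : IsL1Algebra Bicyclic A δ) (F : (TA ⧸ MS.I) →L[ℂ] ℂ) (s t : Bicyclic) (a x : A) :
    ‖F (Submodule.Quotient.mk (MS.tp (a * δ s) (δ t * x)))‖ ≤ ‖F‖ * (‖a‖ * ‖x‖) := by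
  refine (MS.norm_mk_tp_le F _ _).trans ?_
  gcongr
  · simpa [hA.norm_delta] using norm_mul_le a (δ s)
  · simpa [hA.norm_delta] using norm_mul_le (δ t) x

theorem norm_mk_delta_tp_le (MS : ModuleSetting.{u, u, v, w} Ae A TA)
    (hA : IsL1Algebra Bicyclic A δ) (F : (TA ⧸ MS.I) →L[ℂ] ℂ) (s t : Bicyclic) (x : A) :
    ‖F (Submodule.Quotient.mk (MS.tp (δ s) (δ t * x)))‖ ≤ ‖F‖ * ‖x‖ := by
  refine (MS.norm_mk_tp_le F _ _).trans ?_
  rw [hA.norm_delta, one_mul]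
  gcongr
  simpa [hA.norm_delta] using norm_mul_le (δ t) x

/-- Averaging a functional on `𝒜 ⊗̂_𝔄 𝒜` along the tensors `aᵐ ⊗ bᵐ`. -/
theorem exists_average (MS : ModuleSetting.{u, u, v, w} Ae A TA)
    (hA : IsL1Algebra Bicyclic A δ) (hAe : IsL1Algebra NatMax Ae δE) {f : Ae →L[ℂ] ℂ}
    (hf : ∀ e : NatMax, f (δE e) = 1) (htriv : MS.TrivialLeftAction f)
    (hr : ∀ (e : NatMax) (s : Bicyclic), MS.rsmul (δE e) (δ s) = δ (s * bicyclicIdem e))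
    (F : (TA ⧸ MS.I) →L[ℂ] ℂ) :
    ∃ G : (A ⧸ MS.J) →L[ℂ] ℂ, ‖G‖ ≤ ‖F‖ ∧ ∀ x : A, G (Submodule.Quotient.mk x) =
      banachLim fun m => F (Submodule.Quotient.mk (MS.tp (δ ⟨m, 0⟩) (δ ⟨0, m⟩ * x))) := by
  have := MS.isScalarTower
  have := MS.smulCommClass
  obtain ⟨G₀, hG₀, hG₀x⟩ := exists_banachLim_functional
    (fun m => (F.comp MS.I.mkQL).comp
      ((MS.tpL (δ ⟨m, 0⟩)).comp (ContinuousLinearMap.mul ℂ A (δ ⟨0, m⟩)))) (norm_nonneg F)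
    fun m x => MS.norm_mk_delta_tp_le hA F ⟨m, 0⟩ ⟨0, m⟩ x
  have hJ : MS.J ≤ LinearMap.ker (G₀ : A →ₗ[ℂ] ℂ) := fun x hx =>
    MS.eq_zero_of_mem_J hA hAe hf htriv hr (fun s t h => by
      rw [hG₀x, hG₀x]
      congr 1
      funext m
      change F (Submodule.Quotient.mk (MS.tp _ (_ * _))) =
        F (Submodule.Quotient.mk (MS.tp _ (_ * _)))
      rw [hA.delta_mul, hA.delta_mul,
        MS.mk_tp_eq hf htriv hr _ ((SameDegree.refl (⟨0, m⟩ : Bicyclic)).mul h)]) hx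
  refine ⟨(MS.J.liftQ (G₀ : A →ₗ[ℂ] ℂ) hJ).mkContinuous ‖F‖ fun x => ?_,
    LinearMap.mkContinuous_norm_le _ (norm_nonneg F) _, fun x => hG₀x x⟩
  refine le_of_forall_pos_le_add fun ε hε => ?_
  obtain ⟨y, rfl, hy⟩ := Submodule.Quotient.norm_mk_lt x
    (show 0 < ε / (‖F‖ + 1) by positivity)
  calc ‖G₀ y‖ ≤ ‖F‖ * ‖y‖ := G₀.le_of_opNorm_le hG₀ y
    _ ≤ ‖F‖ * (‖(Submodule.Quotient.mk y : A ⧸ MS.J)‖ + ε / (‖F‖ + 1)) := by gcongr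
    _ = ‖F‖ * ‖(Submodule.Quotient.mk y : A ⧸ MS.J)‖ + ‖F‖ / (‖F‖ + 1) * ε := by ring
    _ ≤ _ := by
      gcongr
      refine mul_le_of_le_one_left hε.le ((div_le_one (by positivity)).2 ?_)
      linarith

theorem moduleBiflat (MS : ModuleSetting.{u, u, v, w} Ae A TA)
    (hA : IsL1Algebra Bicyclic A δ) (hAe : IsL1Algebra NatMax Ae δE) {f : Ae →L[ℂ] ℂ}
    (hf : ∀ e : NatMax, f (δE e) = 1) (htriv : MS.TrivialLeftAction f)
    (hr : ∀ (e : NatMax) (s : Bicyclic), MS.rsmul (δE e) (δ s) = δ (s * bicyclicIdem e)) :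
    MS.ModuleBiflat := by
  have := MS.isScalarTower
  have := MS.smulCommClass
  have hb := fun (F : (TA ⧸ MS.I) →L[ℂ] ℂ) (x : A) (m : ℕ) =>
    MS.norm_mk_delta_tp_le hA F ⟨m, 0⟩ ⟨0, m⟩ x
  choose θ hθn hθ using MS.exists_average hA hAe hf htriv hr
  have hext : ∀ G H : (A ⧸ MS.J) →L[ℂ] ℂ,
      (∀ x : A, G (Submodule.Quotient.mk x) = H (Submodule.Quotient.mk x)) → G = H := by
    intro G H h
    ext x
    obtain ⟨x, rfl⟩ := Submodule.Quotient.mk_surjective _ x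
    exact h x
  refine ⟨θ, fun F G => hext _ _ fun x => ?_, ⟨1, fun F => by simpa using hθn F⟩,
    fun α F => hext _ _ fun x => ?_, fun α F => hext _ _ fun x => ?_,
    fun a F => hext _ _ fun x => ?_, fun a F => hext _ _ fun x => ?_,
    fun G => hext _ _ fun x => ?_⟩
  · rw [add_apply, hθ, hθ, hθ, ← banachLim_add (hb F x) (hb G x)]
    rfl
  · simp only [ContinuousLinearMap.comp_apply, hθ, MS.qrsmul_mk, MS.qtrsmul_mk, MS.trsmul_tp,
      MS.rsmul_compat]
  · simp only [ContinuousLinearMap.comp_apply, hθ, MS.qlsmul_mk, MS.qtlsmul_mk, MS.tlsmul_tp,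
      htriv α, MS.tp_smul_left, mul_smul_comm, MS.tp_smul_right]
  · simp only [ContinuousLinearMap.comp_apply, hθ, MS.qrmul_mk, MS.qmulR_mk, MS.rmul_tp,
      mul_assoc]
  · obtain ⟨L, -, hL⟩ := exists_banachLim_functional
      (fun m => (F.comp MS.I.mkQL).comp
        ((MS.tpL.flip (δ ⟨0, m⟩ * x)).comp ((ContinuousLinearMap.mul ℂ A).flip (δ ⟨m, 0⟩))))
      (mul_nonneg (norm_nonneg F) (norm_nonneg x))
      fun m a => by
        rw [mul_right_comm, mul_assoc]
        exact MS.norm_mk_tp_delta_le hA F ⟨m, 0⟩ ⟨0, m⟩ a x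
    replace hL : ∀ y, L y = banachLim fun m =>
        F (Submodule.Quotient.mk (MS.tp (y * δ ⟨m, 0⟩) (δ ⟨0, m⟩ * x))) := hL
    have h1 : L = ((θ F).comp MS.J.mkQL).comp ((ContinuousLinearMap.mul ℂ A).flip x) :=
      ContinuousLinearMap.ext_on hA.dense_span (by
        rintro _ ⟨⟨p, q⟩, rfl⟩
        change _ = θ F (Submodule.Quotient.mk (δ ⟨p, q⟩ * x))
        rw [hL, hθ, ← banachLim_shift (hb F _) p,
          ← banachLim_shift (fun m => MS.norm_mk_tp_delta_le hA F ⟨m, 0⟩ ⟨0, m⟩ _ x) q]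
        congr 1
        funext m
        rw [← mul_assoc, hA.delta_mul, hA.delta_mul, mk_mul_mk, mk_mul_mk]
        congr 5 <;> simp <;> omega)
    simp only [ContinuousLinearMap.comp_apply, hθ, MS.qlmul_mk, MS.qmulL_mk, MS.lmul_tp]
    have h2 := congrArg (fun g => g a) h1
    rw [← hθ]
    simp only [hL] at h2
    exact h2
  · rw [hθ, ← banachLim_const (G (Submodule.Quotient.mk x))]
    congr 1
    funext m
    rw [ContinuousLinearMap.comp_apply, MS.qω_mk, MS.ω_tp, ← mul_assoc, hA.delta_mul]
    have h1 : (G.comp MS.J.mkQL).comp (ContinuousLinearMap.mul ℂ A (δ (⟨m, 0⟩ * ⟨0, m⟩))) =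
        G.comp MS.J.mkQL := ContinuousLinearMap.ext_on hA.dense_span (by
      rintro _ ⟨s, rfl⟩
      change G (Submodule.Quotient.mk (_ * _)) = G (Submodule.Quotient.mk _)
      rw [hA.delta_mul, MS.mk_delta_eq hA hf htriv hr]
      simp only [SameDegree, Bicyclic.mul_def]
      omega)
    exact congrArg (fun g => g x) h1

end ModuleSetting

end BicyclicAlgebra

/-- Example 4.5 (ii), second part.
Let `𝒞` be the bicyclic inverse semigroup, with idempotent set `E_𝒞 = {aⁿbⁿ}` (embedded
via `bicyclicIdem`), and let `ℓ¹(E_𝒞)` act on `ℓ¹(𝒞)` trivially from the left and by right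
convolution.  Then `ℓ¹(𝒞)` is module biflat as an `ℓ¹(E_𝒞)`-module, but not module
biprojective. -/
theorem stmt19 {A Ae : Type u} {TA : Type v}
    [NonUnitalNormedRing A] [NormedSpace ℂ A] [CompleteSpace A]
    [NonUnitalNormedRing Ae] [NormedSpace ℂ Ae] [CompleteSpace Ae]
    [NonUnitalNormedRing TA] [NormedSpace ℂ TA] [CompleteSpace TA]
    (δ : Bicyclic → A) (hA : IsL1Algebra Bicyclic A δ)
    (δE : NatMax → Ae) (hAe : IsL1Algebra NatMax Ae δE)
    (MS : ModuleSetting Ae A TA)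
    (f : Ae →L[ℂ] ℂ) (hf : ∀ e : NatMax, f (δE e) = 1) (htriv : MS.TrivialLeftAction f)
    (hr : ∀ (e : NatMax) (s : Bicyclic), MS.rsmul (δE e) (δ s) = δ (s * bicyclicIdem e)) :
    MS.ModuleBiflat ∧ ¬ MS.ModuleBiprojective := by
  exact ⟨MS.moduleBiflat hA hAe hf htriv hr, MS.not_moduleBiprojective hA hAe hf htriv hr⟩
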